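/- arXiv:2602.15986 — 2 statements merged into one kernel-verified Lean document; each statement's English description precedes it below -/
import Mathlib

section
/- Let G(n) be the adjacency matrix of the path graph on n = 2m vertices (m ≥ 1) and let δ = 1/2. Then the vector x defined by x_i = 1/2 + (−1)^i (i/(2m+1) − 1/2) for i = 1,…,2m satisfies (I + (1/2)·G(n)) x = 𝟙 and x_i > 0 for all i. Hence the unique equilibrium of the network game on the even path at δ = 1/2 has all agents active. -/
open Matrix Finset Real

/-- Adjacency matrix of the path graph on `n` vertices:
`g i j = 1` iff `|i − j| = 1`. -/
def pathAdj (n : ℕ) : Matrix (Fin n) (Fin n) ℝ :=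
  Matrix.of fun i j => if (i : ℕ) + 1 = (j : ℕ) ∨ (j : ℕ) + 1 = (i : ℕ) then 1 else 0

/-- If `g` vanishes at both virtual endpoints `0` and `n + 1`, then the neighbour sum of
`j ↦ g (j + 1)` on the path is `g i + g (i + 2)` at every vertex. -/
theorem sum_pathAdj_mul {n : ℕ} (g : ℕ → ℝ) (h₀ : g 0 = 0) (h₁ : g (n + 1) = 0) (i : Fin n) :
    ∑ j, pathAdj n i j * g (j + 1) = g i + g (i + 2) := by
  have hsplit : ∀ j : Fin n, pathAdj n i j * g (j + 1) =
      (if (j : ℕ) + 1 = i then g i else 0) + (if (i : ℕ) + 1 = j then g (i + 2) else 0) := by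
    intro j
    simp only [pathAdj, Matrix.of_apply]
    split_ifs <;> grind
  have hleft : ∑ j : Fin n, (if (j : ℕ) + 1 = i then g i else 0) = g i := by
    by_cases hi : (i : ℕ) = 0
    · simp [hi, h₀]
    · rw [Finset.sum_eq_single (⟨i - 1, by omega⟩ : Fin n)]
      · exact if_pos (by simp only; omega)
      · exact fun j _ hj => if_neg fun h => hj (Fin.ext (by simp only; omega))
      · simp
  have hright : ∑ j : Fin n, (if (i : ℕ) + 1 = j then g (i + 2) else 0) = g (i + 2) := by
    by_cases hi : (i : ℕ) + 1 < n
    · rw [Finset.sum_eq_single (⟨i + 1, hi⟩ : Fin n)]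
      · exact if_pos rfl
      · exact fun j _ hj => if_neg fun h => hj (Fin.ext h.symm)
      · simp
    · have : (i : ℕ) + 2 = n + 1 := by omega
      simp [this, h₁]
  rw [Finset.sum_congr rfl fun j _ => hsplit j, Finset.sum_add_distrib, hleft, hright]

/-- on the even path with `2m` vertices at `δ = 1/2`, the vector
with (1-based) entries `x_i = 1/2 + (−1)^i (i/(2m+1) − 1/2)` solves
`(I + (1/2)G(2m)) x = 𝟙`, is entrywise positive, and hence is the unique
all-active equilibrium. -/
theorem evenPath_allActive_at_half
    (m : ℕ) (hm : 1 ≤ m)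
    (x : Fin (2*m) → ℝ)
    (hx : ∀ i, x i = 1/2 + (-1 : ℝ)^((i : ℕ) + 1) * (((i : ℕ) + 1) / (2*m+1) - 1/2)) :
    (1 + (1/2 : ℝ) • pathAdj (2*m)).mulVec x = (fun _ => 1) ∧
    (∀ i, 0 < x i) ∧
    (∀ i, x i = max 0 (1 - (1/2 : ℝ) * ∑ j, pathAdj (2*m) i j * x j)) := by
  have hpos : ∀ i, 0 < x i := by
    intro i
    have hM : (0 : ℝ) < 2 * m + 1 := by positivity
    have hi : ((i : ℕ) : ℝ) + 1 < 2 * m + 1 := by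
      have := i.isLt
      exact_mod_cast Nat.succ_lt_succ this
    have hlt : (((i : ℕ) : ℝ) + 1) / (2 * m + 1) < 1 := (div_lt_one hM).2 hi
    have hgt : (0 : ℝ) < (((i : ℕ) : ℝ) + 1) / (2 * m + 1) := by positivity
    rw [hx i]
    rcases neg_one_pow_eq_or ℝ ((i : ℕ) + 1) with h | h <;> rw [h] <;> linarith
  have hsum : ∀ i, ∑ j, pathAdj (2*m) i j * x j = 2 - 2 * x i := by
    intro i
    have hM : (2 * m + 1 : ℝ) ≠ 0 := by positivity
    have hg := sum_pathAdj_mul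
      (fun k : ℕ => 1/2 + (-1 : ℝ)^k * ((k : ℝ) / (2*m+1) - 1/2))
      (by norm_num) (by
        have : (((2 * m + 1 : ℕ) : ℝ)) / (2 * m + 1) = 1 := by push_cast; exact div_self hM
        simp only [this, pow_succ, pow_mul]
        norm_num) i
    simp only [Nat.cast_add, Nat.cast_one, Nat.cast_ofNat, ← hx] at hg
    rw [hg, hx i, pow_add, pow_add]
    field_simp
    ring
  refine ⟨?_, hpos, fun i => ?_⟩
  · funext i
    rw [Matrix.add_mulVec, Matrix.one_mulVec, Matrix.smul_mulVec, Pi.add_apply, Pi.smul_apply,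
      smul_eq_mul, Matrix.mulVec, dotProduct, hsum i]
    ring
  · rw [hsum i, show 1 - (1/2 : ℝ) * (2 - 2 * x i) = x i by ring, max_eq_right (hpos i).le]
end

section
/- Fix m ≥ 1 and let δ lie in the open interval (−1/(2cos((2m+2)π/(2m+3))), −1/(2cos(2mπ/(2m+1)))), i.e., δ ∈ (1/|λ_min(G(2m+2))|, 1/|λ_min(G(2m))|). Then I + δG(2m) is invertible, and with b(δ,2m) denoting the first entry of (I + δG(2m))⁻¹𝟙, one has δ·(b(δ,2m) + 1) > 1. In the notation of the paper, b(δ,2m) + b(δ,1) > 1/δ, so an agent separating a block of 2m active agents from a block of 1 active agent can remain inactive in equilibrium. -/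
open Matrix Finset Real

lemma one_add_smul_pathAdj_mulVec {n : ℕ} (δ : ℝ) {f : ℕ → ℝ} (h0 : f 0 = 0)
    (hn : f (n + 1) = 0) (k : Fin n) :
    ((1 + δ • pathAdj n).mulVec fun i => f (i + 1)) k
      = f (k + 1) + δ * (f k + f (k + 2)) := by
  have hadj : (pathAdj n).mulVec (fun i => f (i + 1)) k = f k + f (k + 2) := by
    obtain ⟨k, hk⟩ := k
    have hsplit : ∀ j : ℕ, (if k + 1 = j ∨ j + 1 = k then (1 : ℝ) else 0) * f (j + 1)
        = (if k + 1 = j then f (j + 1) else 0) + (if j + 1 = k then f (j + 1) else 0) := by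
      intro j
      split_ifs <;> first | omega | simp
    simp only [Matrix.mulVec, dotProduct, pathAdj, Matrix.of_apply, hsplit]
    rw [Fin.sum_univ_eq_sum_range (fun j => (if k + 1 = j then f (j + 1) else 0)
      + (if j + 1 = k then f (j + 1) else 0)) n, Finset.sum_add_distrib, Finset.sum_ite_eq,
      add_comm]
    congr 1
    · cases k with
      | zero => simp [h0]
      | succ k =>
        simp only [Nat.add_right_cancel_iff, Finset.sum_ite_eq', Finset.mem_range]
        rw [if_pos (by omega)]
    · split_ifs with h
      · rfl
      · obtain rfl : n = k + 1 := by
          rw [Finset.mem_range] at h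
          omega
        exact hn.symm
  rw [Matrix.add_mulVec, Matrix.one_mulVec, Matrix.smul_mulVec, Pi.add_apply, Pi.smul_apply, hadj,
    smul_eq_mul]

lemma mul_sin_eq_of_recurrence {n : ℕ} {φ : ℝ} {f : ℕ → ℝ} (h0 : f 0 = 0)
    (hrec : ∀ k < n, 2 * cos φ * f (k + 1) + (f k + f (k + 2)) = 0) (k : ℕ) (hk : k ≤ n) :
    f k * sin φ = -(-1) ^ k * sin (k * φ) * f 1 ∧
      f (k + 1) * sin φ = (-1) ^ k * sin ((k + 1) * φ) * f 1 := by
  induction k with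
  | zero => simp [h0, mul_comm]
  | succ k ih =>
    obtain ⟨h1, h2⟩ := ih (by omega)
    refine ⟨by push_cast; rw [h2]; ring, ?_⟩
    have hsin : sin ((k + 1 + 1) * φ) + sin (k * φ) = 2 * cos φ * sin ((k + 1) * φ) := by
      rw [show (k + 1 + 1 : ℝ) * φ = (k + 1) * φ + φ by ring,
        show (k : ℝ) * φ = (k + 1) * φ - φ by ring, sin_add, sin_sub]
      ring
    push_cast
    linear_combination (hrec k (by omega)) * sin φ - 2 * cos φ * h2 - h1
      + (-1) ^ k * f 1 * hsin

lemma isUnit_det_one_add_smul_pathAdj {n : ℕ} {δ φ : ℝ} (hδ : δ * (2 * cos φ) = 1)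
    (hφ : sin φ ≠ 0) (hnφ : sin ((n + 1) * φ) ≠ 0) :
    IsUnit (1 + δ • pathAdj n).det := by
  rw [isUnit_iff_ne_zero]
  intro hdet
  obtain ⟨v, hv, hAv⟩ := Matrix.exists_mulVec_eq_zero_iff.mpr hdet
  let f : ℕ → ℝ := fun k => if h : 0 < k ∧ k ≤ n then v ⟨k - 1, by omega⟩ else 0
  have hf0 : f 0 = 0 := by simp [f]
  have hfn : f (n + 1) = 0 := by simp [f]
  have hvf : v = fun i : Fin n => f (i + 1) := by
    funext i
    simp [f]
  have hrec : ∀ k < n, 2 * cos φ * f (k + 1) + (f k + f (k + 2)) = 0 := by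
    intro k hk
    have h := one_add_smul_pathAdj_mulVec δ hf0 hfn ⟨k, hk⟩
    rw [← hvf, hAv, Pi.zero_apply] at h
    linear_combination -(2 * cos φ) * h - (f k + f (k + 2)) * hδ
  have hf1 : f 1 = 0 := by
    have h := (mul_sin_eq_of_recurrence hf0 hrec n le_rfl).2
    rw [hfn, zero_mul] at h
    simpa [hnφ] using h.symm
  refine hv ?_
  rw [hvf]
  funext i
  have h := (mul_sin_eq_of_recurrence hf0 hrec i i.2.le).2
  simpa [hf1, hφ] using h

/-- With `δ = 1 / (2 cos φ)`, the endpoint entry of `(I + δG(2m))⁻¹𝟙` in closed form. -/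
lemma inv_one_add_smul_pathAdj_mulVec_zero {m : ℕ} (hm : 0 < 2 * m) {δ φ : ℝ}
    (hδ : δ * (2 * cos φ) = 1) (hcos : 1 + cos φ ≠ 0) (hS : sin ((m + 1 / 2) * φ) ≠ 0)
    (hdet : IsUnit (1 + δ • pathAdj (2 * m)).det) :
    ((1 + δ • pathAdj (2 * m))⁻¹.mulVec (fun _ => 1)) ⟨0, hm⟩
      = cos φ / (1 + cos φ) * (1 + sin ((m - 1 / 2) * φ) / sin ((m + 1 / 2) * φ)) := by
  let f : ℕ → ℝ := fun k =>
    cos φ / (1 + cos φ) * (1 - (-1) ^ k * sin ((m + 1 / 2 - k) * φ) / sin ((m + 1 / 2) * φ))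
  have hf0 : f 0 = 0 := by
    simp only [f, Nat.cast_zero, sub_zero, pow_zero, one_mul, div_self hS, sub_self, mul_zero]
  have hfn : f (2 * m + 1) = 0 := by
    have : ((m : ℝ) + 1 / 2 - ((2 * m + 1 : ℕ) : ℝ)) * φ = -((m + 1 / 2) * φ) := by
      push_cast
      ring
    have hpow : (-1 : ℝ) ^ (2 * m + 1) = -1 := Odd.neg_one_pow ⟨m, rfl⟩
    simp only [f, this, sin_neg, hpow, neg_mul_neg, one_mul, div_self hS, sub_self, mul_zero]
  have hsol : (1 + δ • pathAdj (2 * m)).mulVec (fun i => f (i + 1)) = fun _ => 1 := by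
    funext k
    rw [one_add_smul_pathAdj_mulVec δ hf0 hfn]
    generalize (k : ℕ) = k
    have hsin : sin ((m + 1 / 2 - k) * φ) + sin ((m + 1 / 2 - (k + 2)) * φ)
        = 2 * cos φ * sin ((m + 1 / 2 - (k + 1)) * φ) := by
      rw [show (m + 1 / 2 - k : ℝ) * φ = (m + 1 / 2 - (k + 1)) * φ + φ by ring,
        show (m + 1 / 2 - (k + 2) : ℝ) * φ = (m + 1 / 2 - (k + 1)) * φ - φ by ring,
        sin_add, sin_sub]
      ring
    have hsum : 2 * cos φ * f (k + 1) + (f k + f (k + 2)) = 2 * cos φ := by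
      simp only [f]
      push_cast
      generalize sin ((m + 1 / 2) * φ) = s at hS ⊢
      generalize sin ((m + 1 / 2 - k) * φ) = a at hsin ⊢
      generalize sin ((m + 1 / 2 - (k + 1)) * φ) = b at hsin ⊢
      generalize sin ((m + 1 / 2 - (k + 2)) * φ) = c at hsin ⊢
      field_simp
      linear_combination -(-1) ^ k * cos φ * hsin
    linear_combination δ * hsum + (1 - f (k + 1)) * hδ
  rw [← hsol, Matrix.mulVec_mulVec, Matrix.nonsing_inv_mul _ hdet, Matrix.one_mulVec]
  simp only [f]
  rw [show (m + 1 / 2 - ((0 + 1 : ℕ) : ℝ)) * φ = (m - 1 / 2) * φ by push_cast; ring]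
  ring

lemma two_cos_lt_of_cos_neg {x φ : ℝ} (hcos : 0 < 1 + cos φ) (hφ : 0 < sin φ)
    (hS : 0 < sin ((x + 1 / 2) * φ)) (hneg : cos ((x + 3 / 2) * φ) < 0) :
    2 * cos φ < cos φ / (1 + cos φ) * (1 + sin ((x - 1 / 2) * φ) / sin ((x + 1 / 2) * φ)) + 1 := by
  have hkey : cos φ * (sin ((x + 1 / 2) * φ) + sin ((x - 1 / 2) * φ))
      - (2 * cos φ - 1) * (1 + cos φ) * sin ((x + 1 / 2) * φ)
      = -sin φ * cos ((x + 3 / 2) * φ) := by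
    rw [show (x - 1 / 2) * φ = (x + 1 / 2) * φ - φ by ring,
      show (x + 3 / 2) * φ = (x + 1 / 2) * φ + φ by ring, sin_sub, cos_add]
    linear_combination (-sin ((x + 1 / 2) * φ)) * sin_sq_add_cos_sq φ
  have hpos : 0 < -sin φ * cos ((x + 3 / 2) * φ) := mul_pos_of_neg_of_neg (by linarith) hneg
  rw [← sub_lt_iff_lt_add, one_add_div hS.ne', div_mul_div_comm, lt_div_iff₀ (by positivity)]
  linarith

/-- for `δ ∈ (1/|λ_min(G(2m+2))|, 1/|λ_min(G(2m))|)`, i.e.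
`δ ∈ (−1/(2cos((2m+2)π/(2m+3))), −1/(2cos(2mπ/(2m+1))))`, the matrix
`I + δG(2m)` is invertible, and the endpoint entry `b(δ,2m)` of
`(I + δG(2m))⁻¹𝟙` satisfies `δ·(b(δ,2m) + 1) > 1`, i.e.
`b(δ,2m) + b(δ,1) > 1/δ`. -/
theorem endpoint_2m_plus_1_supports_separator
    (m : ℕ) (hm : 1 ≤ m) (δ : ℝ)
    (hδ : δ ∈ Set.Ioo (-1 / (2 * Real.cos ((2*m+2) * Real.pi / (2*m+3))))
                      (-1 / (2 * Real.cos ((2*m) * Real.pi / (2*m+1))))) :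
    IsUnit (1 + δ • pathAdj (2*m)).det ∧
    1 < δ * (((1 + δ • pathAdj (2*m))⁻¹.mulVec (fun _ => 1)) ⟨0, by omega⟩ + 1) := by
  have hm' : (1 : ℝ) ≤ m := by exact_mod_cast hm
  have hpi := Real.pi_pos
  have hcos1 : Real.cos ((2 * m + 2) * π / (2 * m + 3)) = -cos (π / (2 * m + 3)) := by
    rw [← cos_pi_sub]
    congr 1
    field_simp
    ring
  have hcos2 : Real.cos ((2 * m) * π / (2 * m + 1)) = -cos (π / (2 * m + 1)) := by
    rw [← cos_pi_sub]
    congr 1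
    field_simp
    ring
  have hα : π / (2 * m + 3) < π / 2 := by
    gcongr
    linarith
  have hβ : π / (2 * m + 1) < π / 2 := by
    gcongr
    linarith
  have hα0 : 0 < π / (2 * m + 3) := by positivity
  have hβ0 : 0 < π / (2 * m + 1) := by positivity
  have hcα : 0 < cos (π / (2 * m + 3)) := cos_pos_of_mem_Ioo ⟨by linarith, hα⟩
  have hcβ : 0 < cos (π / (2 * m + 1)) := cos_pos_of_mem_Ioo ⟨by linarith, hβ⟩
  rw [hcos1, hcos2, mul_neg, mul_neg, neg_div_neg_eq, neg_div_neg_eq] at hδ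
  obtain ⟨hδ1, hδ2⟩ := hδ
  have hδ0 : 0 < δ := lt_trans (by positivity) hδ1
  rw [div_lt_iff₀ (by positivity)] at hδ1
  rw [lt_div_iff₀ (by positivity)] at hδ2
  have hlt : 1 / (2 * δ) < cos (π / (2 * m + 3)) := by
    rw [div_lt_iff₀ (by positivity)]
    linarith
  have hgt : cos (π / (2 * m + 1)) < 1 / (2 * δ) := by
    rw [lt_div_iff₀ (by positivity)]
    linarith
  obtain ⟨φ, hφ0, hφπ, hφ⟩ : ∃ φ, 0 ≤ φ ∧ φ ≤ π ∧ cos φ = 1 / (2 * δ) :=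
    ⟨arccos (1 / (2 * δ)), arccos_nonneg _, arccos_le_pi _,
      cos_arccos (by linarith) (hlt.le.trans (cos_le_one _))⟩
  have hαφ : π / (2 * m + 3) < φ := by
    by_contra! h
    linarith [cos_le_cos_of_nonneg_of_le_pi hφ0 (by linarith) h]
  have hφβ : φ < π / (2 * m + 1) := by
    by_contra! h
    linarith [cos_le_cos_of_nonneg_of_le_pi hβ0.le hφπ h]
  have hδφ : δ * (2 * cos φ) = 1 := by
    rw [hφ]
    field_simp
  have hcφ : 0 < 1 + cos φ := by
    rw [hφ]
    positivity
  rw [div_lt_iff₀ (by positivity)] at hαφ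
  have hφβ' := hφβ
  rw [lt_div_iff₀ (by positivity)] at hφβ
  have hφpos : 0 < φ := by
    by_contra! h
    nlinarith
  have hmφ : 0 < m * φ := by positivity
  have hm1φ : φ ≤ m * φ := le_mul_of_one_le_left hφ0 hm'
  have hS : 0 < sin ((m + 1 / 2) * φ) := sin_pos_of_pos_of_lt_pi (by positivity) (by linarith)
  have hdet : IsUnit (1 + δ • pathAdj (2 * m)).det := by
    refine isUnit_det_one_add_smul_pathAdj hδφ
      (sin_pos_of_pos_of_lt_pi hφpos (by linarith)).ne' (ne_of_gt ?_)
    push_cast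
    exact sin_pos_of_pos_of_lt_pi (by positivity) (by linarith)
  refine ⟨hdet, ?_⟩
  rw [inv_one_add_smul_pathAdj_mulVec_zero (by omega) hδφ hcφ.ne' hS.ne' hdet]
  nth_rewrite 1 [← hδφ]
  refine mul_lt_mul_of_pos_left (two_cos_lt_of_cos_neg hcφ
    (sin_pos_of_pos_of_lt_pi (by positivity) (by linarith)) hS
    (cos_neg_of_pi_div_two_lt_of_lt (by linarith) (by linarith))) hδ0
end
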